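/- For every positive integer n there exists a constant J(n) such that for every prime p, every field k of characteristic p, and every finite subgroup Γ of GL_n(k) whose order is not divisible by p, Γ contains a normal abelian subgroup A with index [Γ : A] ≤ J(n). -/

import Mathlib

/-- The unit ball of the endomorphisms of a complex Euclidean space is covered by a number of
`ε`-balls that depends only on the dimension. -/
theorem exists_covering_number (n : ℕ) {ε : ℝ} (hε : 0 < ε) :
    ∃ N : ℕ, ∀ (V : Type) [NormedAddCommGroup V] [InnerProductSpace ℂ V] [FiniteDimensional ℂ V],
      Module.finrank ℂ V = n → ∃ c : (V →L[ℂ] V) → Fin N, ∀ S T : V →L[ℂ] V, ‖S‖ ≤ 1 → ‖T‖ ≤ 1 →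
        c S = c T → ‖S - T‖ ≤ ε := by
  obtain ⟨t, ht, htc⟩ := Metric.totallyBounded_iff.1
    (isCompact_closedBall (0 : EuclideanSpace ℂ (Fin n) →L[ℂ] EuclideanSpace ℂ (Fin n)) 1
      ).totallyBounded (ε / 2) (half_pos hε)
  have := ht.to_subtype
  have hex : ∀ x : EuclideanSpace ℂ (Fin n) →L[ℂ] EuclideanSpace ℂ (Fin n), ‖x‖ ≤ 1 →
      ∃ y : t, dist x y < ε / 2 := fun x hx ↦ by
    obtain ⟨y, hy, hxy⟩ := Set.mem_iUnion₂.1 (htc (mem_closedBall_zero_iff.2 hx))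
    exact ⟨⟨y, hy⟩, hxy⟩
  have : Nonempty t := ⟨(hex 0 (by simp)).choose⟩
  choose! d hd using hex
  refine ⟨Nat.card t, fun V _ _ _ hV ↦ ?_⟩
  let e : V ≃ₗᵢ[ℂ] EuclideanSpace ℂ (Fin n) :=
    (stdOrthonormalBasis ℂ V).repr.trans
      (LinearIsometryEquiv.piLpCongrLeft 2 ℂ ℂ (finCongr hV))
  let φ : (V →L[ℂ] V) → (EuclideanSpace ℂ (Fin n) →L[ℂ] EuclideanSpace ℂ (Fin n)) := fun T ↦
    (e.toContinuousLinearEquiv : V →L[ℂ] _).comp (T.comp (e.symm.toContinuousLinearEquiv : _ →L[ℂ] V))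
  have hφ : ∀ T, ‖T‖ ≤ 1 → ‖φ T‖ ≤ 1 := fun T hT ↦
    ContinuousLinearMap.opNorm_le_bound _ zero_le_one fun x ↦ by
      simpa [φ] using T.le_of_opNorm_le hT (e.symm x)
  refine ⟨fun T ↦ Finite.equivFin t (d (φ T)), fun S T hS hT h ↦ ?_⟩
  have h' : d (φ S) = d (φ T) := (Finite.equivFin t).injective h
  have hdist : ‖φ S - φ T‖ ≤ ε := by
    rw [← dist_eq_norm]
    have h1 := hd _ (hφ S hS)
    have h2 := hd _ (hφ T hT)
    rw [h'] at h1
    linarith [dist_triangle_right (φ S) (φ T) (d (φ T))]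
  refine ContinuousLinearMap.opNorm_le_bound _ hε.le fun x ↦ ?_
  have := (φ S - φ T).le_of_opNorm_le hdist (e x)
  simpa [φ, ← map_sub] using this

/-- A root of unity of bounded order which is close enough to `1` is equal to `1`. -/
theorem exists_isolating_radius (n : ℕ) (hn : 0 < n) :
    ∃ δ : ℝ, 0 < δ ∧ ∀ z : ℂ, z ^ n = 1 → ‖z - 1‖ < δ → z = 1 := by
  have hfin : {z : ℂ | z ^ n = 1}.Finite := by
    refine (Polynomial.nthRootsFinset n (1 : ℂ)).finite_toSet.subset fun z hz ↦ ?_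
    simpa [Polynomial.mem_nthRootsFinset hn] using hz
  have hopen := (hfin.subset (Set.sdiff_subset (t := {1}))).isClosed.isOpen_compl
  obtain ⟨δ, hδ, hball⟩ := Metric.isOpen_iff.1 hopen 1 (by simp)
  refine ⟨δ, hδ, fun z hz hz1 ↦ ?_⟩
  by_contra hne
  exact hball (by simpa [dist_eq_norm] using hz1) ⟨hz, hne⟩

theorem commute_map_of_mem_closure {G A : Type} [Group G] [Monoid A] (ρ : G →* A) {S : Set G}
    {t : A} (hS : ∀ a ∈ S, Commute (ρ a) t) {a : G} (ha : a ∈ Subgroup.closure S) :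
    Commute (ρ a) t := by
  induction ha using Subgroup.closure_induction with
  | mem a ha => exact hS a ha
  | one => rw [map_one]; exact Commute.one_left t
  | mul a b _ _ ha hb => rw [map_mul]; exact ha.mul_left hb
  | inv a _ ha => exact Commute.units_inv_left (u := ρ.toHomUnits a) ha

section Unitary

variable {V : Type} [NormedAddCommGroup V] [InnerProductSpace ℂ V] [FiniteDimensional ℂ V]
  {G : Type} [Group G]

theorem norm_map_commutator_sub_one_le {A : Type} [NormedRing A] (ρ : G →* A)
    (hρ : ∀ g, ‖ρ g‖ ≤ 1) (g h : G) :
    ‖ρ (g * h * g⁻¹ * h⁻¹) - 1‖ ≤ 2 * ‖ρ g - 1‖ * ‖ρ h - 1‖ := by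
  have key := norm_commutator_units_sub_one_le (ρ.toHomUnits g) (ρ.toHomUnits h)
  simp only [← map_inv, ← map_mul, MonoidHom.coe_toHomUnits] at key
  refine key.trans ?_
  have : ‖ρ g⁻¹‖ * ‖ρ h⁻¹‖ ≤ 1 := mul_le_one₀ (hρ _) (norm_nonneg _) (hρ _)
  calc _ = 2 * (‖ρ g⁻¹‖ * ‖ρ h⁻¹‖) * (‖ρ g - 1‖ * ‖ρ h - 1‖) := by ring
    _ ≤ 2 * 1 * (‖ρ g - 1‖ * ‖ρ h - 1‖) := by gcongr
    _ = _ := by ring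

/-- The elements of a unitary group which are close to `1` generate a subgroup of bounded index. -/
theorem index_closure_near_one_le {A : Type} [NormedRing A] (ρ : G →* A) (hρ : ∀ g, ‖ρ g‖ ≤ 1)
    {ε : ℝ} {N : ℕ} (c : A → Fin N)
    (hc : ∀ S T : A, ‖S‖ ≤ 1 → ‖T‖ ≤ 1 → c S = c T → ‖S - T‖ ≤ ε) :
    (Subgroup.closure {g : G | ‖ρ g - 1‖ ≤ ε}).index ≤ N := by
  rw [Subgroup.index_eq_card]
  refine (Nat.card_le_card_of_injective
    (fun q : G ⧸ Subgroup.closure {g : G | ‖ρ g - 1‖ ≤ ε} ↦ c (ρ q.out)) fun q r hqr ↦ ?_).trans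
    (Nat.card_fin N).le
  rw [← q.out_eq', ← r.out_eq']
  refine QuotientGroup.eq.2 (Subgroup.subset_closure ?_)
  have h1 := hc _ _ (hρ _) (hρ _) hqr.symm
  have h2 : ρ (q.out⁻¹ * r.out) - 1 = ρ q.out⁻¹ * (ρ r.out - ρ q.out) := by
    rw [mul_sub, ← map_mul, ← map_mul, inv_mul_cancel, map_one]
  rw [Set.mem_ofPred_eq, h2]
  refine (norm_mul_le _ _).trans ?_
  calc _ ≤ 1 * ‖ρ r.out - ρ q.out‖ := by gcongr; exact hρ _
    _ ≤ ε := by rwa [one_mul]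

/-- In a finite unitary group, either the elements close to `1` are all scalar, or some nonscalar
element commutes with all of them. -/
theorem scalar_or_exists_commute_near_one [Nontrivial V] [Finite G] (ρ : G →* (V →L[ℂ] V))
    (hρ : ∀ g, ‖ρ g‖ ≤ 1) {δ ε : ℝ} (hε : ε ≤ 1 / 4) (hεδ : ε < δ)
    (hδ : ∀ z : ℂ, z ^ Module.finrank ℂ V = 1 → ‖z - 1‖ < δ → z = 1) :
    (∀ g, ‖ρ g - 1‖ ≤ ε → ∃ z : ℂ, ρ g = algebraMap ℂ _ z) ∨
      ∃ g, (∀ z : ℂ, ρ g ≠ algebraMap ℂ _ z) ∧ ∀ h, ‖ρ h - 1‖ ≤ ε → Commute (ρ g) (ρ h) := by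
  by_cases hS : ∀ g, ‖ρ g - 1‖ ≤ ε → ∃ z : ℂ, ρ g = algebraMap ℂ _ z
  · exact Or.inl hS
  refine Or.inr ?_
  push Not at hS
  obtain ⟨g, ⟨hgε, hg⟩, hmin⟩ := Set.exists_min_image
    {g | ‖ρ g - 1‖ ≤ ε ∧ ∀ z : ℂ, ρ g ≠ algebraMap ℂ _ z} (fun g ↦ ‖ρ g - 1‖)
    (Set.toFinite _) hS
  refine ⟨g, hg, fun h hh ↦ ?_⟩
  have hpos : 0 < ‖ρ g - 1‖ := norm_pos_iff.2 (sub_ne_zero.2 (by simpa using hg 1))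
  have hlt : ‖ρ (g * h * g⁻¹ * h⁻¹) - 1‖ < ‖ρ g - 1‖ := by
    have := norm_map_commutator_sub_one_le ρ hρ g h
    nlinarith
  have hscal : ∃ z : ℂ, ρ (g * h * g⁻¹ * h⁻¹) = algebraMap ℂ _ z := by
    by_contra! hne
    exact absurd (hmin _ ⟨hlt.le.trans hgε, hne⟩) (not_le.2 hlt)
  obtain ⟨z, hz⟩ := hscal
  have hdet : z ^ Module.finrank ℂ V = 1 := by
    let D : G →* ℂ := (LinearMap.det (M := V)).comp
      ((Module.End.toContinuousLinearMap V).symm.toMonoidHom.comp ρ)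
    have h1 : D (g * h * g⁻¹ * h⁻¹) = 1 := by
      have : D (g * h * g⁻¹ * h⁻¹) = D (g * g⁻¹) * D (h * h⁻¹) := by
        simp only [map_mul]; ring
      simpa using this
    have h2 : D (g * h * g⁻¹ * h⁻¹) = LinearMap.det (z • (1 : V →ₗ[ℂ] V)) := by
      change LinearMap.det ((ρ (g * h * g⁻¹ * h⁻¹) : V →L[ℂ] V) : V →ₗ[ℂ] V) = _
      rw [hz]
      rfl
    rw [h1, LinearMap.det_smul] at h2
    simpa using h2.symm
  have hz1 : z = 1 := by
    refine hδ z hdet ?_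
    have : ‖z - 1‖ = ‖ρ (g * h * g⁻¹ * h⁻¹) - 1‖ := by
      rw [hz, ← map_one (algebraMap ℂ (V →L[ℂ] V)), ← map_sub, norm_algebraMap']
    linarith
  rw [hz1, map_one] at hz
  calc ρ g * ρ h = ρ (g * h * g⁻¹ * h⁻¹) * (ρ h * ρ g) := by
        simp only [← map_mul]; congr 1; group
    _ = ρ h * ρ g := by rw [hz, one_mul]

/-- A finite unitary group of degree `n` has a subgroup of bounded index which is either commutative
or decomposable. -/
theorem exists_commute_or_orthogonal_decomposition (n : ℕ) (hn : 0 < n) :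
    ∃ N : ℕ, ∀ (V : Type) [NormedAddCommGroup V] [InnerProductSpace ℂ V] [FiniteDimensional ℂ V],
      Module.finrank ℂ V = n → ∀ (G : Type) [Group G] [Finite G] (ρ : G →* (V →L[ℂ] V)),
        (∀ g x y, inner ℂ (ρ g x) (ρ g y) = inner ℂ x y) → ∃ H : Subgroup G, H.index ≤ N ∧
          ((∀ a ∈ H, ∀ b ∈ H, Commute (ρ a) (ρ b)) ∨ ∃ E : Submodule ℂ V, E ≠ ⊥ ∧ E ≠ ⊤ ∧
            ∀ h ∈ H, (∀ x ∈ E, ρ h x ∈ E) ∧ ∀ x ∈ Eᗮ, ρ h x ∈ Eᗮ) := by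
  obtain ⟨δ, hδ, hroot⟩ := exists_isolating_radius n hn
  let ε : ℝ := min (1 / 4) (δ / 2)
  have hε : 0 < ε := lt_min (by norm_num) (half_pos hδ)
  have hεδ : ε < δ := (min_le_right _ _).trans_lt (half_lt_self hδ)
  obtain ⟨N, hN⟩ := exists_covering_number n hε
  refine ⟨N, fun V _ _ _ hV G _ _ ρ hinner ↦ ?_⟩
  have : Nontrivial V := Module.finrank_pos_iff.1 (hV ▸ hn)
  obtain ⟨c, hc⟩ := hN V hV
  have hρ : ∀ g, ‖ρ g‖ ≤ 1 := fun g ↦ ContinuousLinearMap.opNorm_le_bound _ zero_le_one fun x ↦ by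
    rw [one_mul, @norm_eq_sqrt_re_inner ℂ, @norm_eq_sqrt_re_inner ℂ _ _ _ _ x, hinner]
  refine ⟨_, index_closure_near_one_le ρ hρ c hc, ?_⟩
  rcases scalar_or_exists_commute_near_one ρ hρ (min_le_left _ _) hεδ (hV ▸ hroot)
    with hscal | ⟨g, hg, hcomm⟩
  · have hscal' : ∀ a ∈ Subgroup.closure {g | ‖ρ g - 1‖ ≤ ε}, ∀ T, Commute (ρ a) T := fun a ha T ↦
      commute_map_of_mem_closure ρ (fun b hb ↦ by
        obtain ⟨z, hz⟩ := hscal b hb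
        rw [hz]
        exact Algebra.commutes z T) ha
    exact Or.inl fun a ha b _ ↦ hscal' a ha _
  · right
    have hcomm' : ∀ h ∈ Subgroup.closure {g | ‖ρ g - 1‖ ≤ ε}, Commute (ρ g) (ρ h) := fun h hh ↦
      (commute_map_of_mem_closure ρ (fun a ha ↦ (hcomm a ha).symm) hh).symm
    obtain ⟨μ, hμ⟩ := Module.End.exists_eigenvalue (ρ g : V →ₗ[ℂ] V)
    have hinv : ∀ h ∈ Subgroup.closure {g | ‖ρ g - 1‖ ≤ ε},
        ∀ x ∈ Module.End.eigenspace (ρ g : V →ₗ[ℂ] V) μ,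
          ρ h x ∈ Module.End.eigenspace (ρ g : V →ₗ[ℂ] V) μ := by
      intro h hh x hx
      rw [Module.End.mem_eigenspace_iff] at hx ⊢
      have := DFunLike.congr_fun (hcomm' h hh).eq x
      simp only [mul_apply_eq_comp, ContinuousLinearMap.coe_coe] at this hx ⊢
      rw [this, hx, map_smul]
    refine ⟨Module.End.eigenspace (ρ g : V →ₗ[ℂ] V) μ, hμ, fun htop ↦ hg μ ?_,
      fun h hh ↦ ⟨hinv h hh, fun x hx y hy ↦ ?_⟩⟩
    · ext x
      exact Module.End.mem_eigenspace_iff.1 (htop ▸ Submodule.mem_top : x ∈ _)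
    · rw [← hinner h⁻¹, ← mul_apply_eq_comp, ← map_mul, inv_mul_cancel, map_one]
      exact hx _ (hinv _ (inv_mem hh) y hy)

end Unitary

/-- A finite complex linear group preserves some inner product. -/
theorem exists_invariant_inner {V : Type} [AddCommGroup V] [Module ℂ V] [FiniteDimensional ℂ V]
    {G : Type} [Group G] [Finite G] (ρ : Representation ℂ G V) :
    ∃ c : InnerProductSpace.Core ℂ V, ∀ g x y, c.inner (ρ g x) (ρ g y) = c.inner x y := by
  have := Fintype.ofFinite G
  let e : V ≃ₗ[ℂ] EuclideanSpace ℂ (Fin (Module.finrank ℂ V)) :=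
    LinearEquiv.ofFinrankEq _ _ (by simp)
  refine ⟨{ inner x y := ∑ g, inner ℂ (e (ρ g x)) (e (ρ g y))
            conj_inner_symm x y := by simp
            re_inner_nonneg x := by
              simpa using Finset.sum_nonneg fun g _ ↦ inner_self_nonneg (𝕜 := ℂ) (x := e (ρ g x))
            add_left x y z := by simp [Finset.sum_add_distrib]
            smul_left x y r := by simp [Finset.mul_sum, mul_comm]
            definite x hx := by
              have hre : ∑ g, ‖e (ρ g x)‖ ^ 2 = 0 := by
                have := congrArg Complex.re hx
                simpa [← Complex.ofReal_pow] using this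
              have := (Finset.sum_eq_zero_iff_of_nonneg fun g _ ↦ sq_nonneg _).1 hre 1
                (Finset.mem_univ _)
              simpa using this }, fun g x y ↦ ?_⟩
  change ∑ h, _ = ∑ h, _
  rw [← Equiv.sum_comp (Equiv.mulRight g) fun h ↦ inner ℂ (e (ρ h x)) (e (ρ h y))]
  simp


theorem index_normalCore_dvd_factorial {G : Type} [Group G] [Finite G] (H : Subgroup G) :
    H.normalCore.index ∣ H.index.factorial := by
  rw [Subgroup.normalCore_eq_ker, Subgroup.index_ker, Subgroup.index_eq_card, ← Nat.card_perm]
  exact Subgroup.card_subgroup_dvd_card _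

/-- **Jordan's theorem** for complex representations of finite groups. -/
theorem exists_index_le_of_complex_representation (n : ℕ) :
    ∃ J : ℕ, ∀ (V : Type) [AddCommGroup V] [Module ℂ V] [FiniteDimensional ℂ V],
      Module.finrank ℂ V = n → ∀ (G : Type) [Group G] [Finite G] (ρ : Representation ℂ G V),
        ∃ A : Subgroup G, A.index ≤ J ∧ ∀ a ∈ A, ∀ b ∈ A, Commute (ρ a) (ρ b) := by
  induction n using Nat.strong_induction_on with
  | _ n ih =>
  rcases Nat.eq_zero_or_pos n with rfl | hn
  · refine ⟨1, fun V _ _ _ hV G _ _ ρ ↦ ⟨⊤, by simp, fun a _ b _ ↦ ?_⟩⟩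
    have := Module.finrank_zero_iff.1 hV
    exact LinearMap.ext fun x ↦ Subsingleton.elim _ _
  choose! J hJ using ih
  let M := ∑ m ∈ Finset.range n, J m + 1
  have hM : ∀ m < n, J m ≤ M := fun m hm ↦
    (Finset.single_le_sum (f := J) (fun _ _ ↦ Nat.zero_le _) (Finset.mem_range.2 hm)).trans
      (Nat.le_succ _)
  obtain ⟨N, hN⟩ := exists_commute_or_orthogonal_decomposition n hn
  refine ⟨M * M * N, fun V _ _ _ hV G _ _ ρ ↦ ?_⟩
  obtain ⟨c, hc⟩ := exists_invariant_inner ρ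
  let : NormedAddCommGroup V := c.toNormedAddCommGroup
  let : InnerProductSpace ℂ V := .ofCore c.toCore
  obtain ⟨H, hH, hcases⟩ := hN V hV G
    ((Module.End.toContinuousLinearMap V).toMonoidHom.comp ρ) hc
  have hMM : 1 ≤ M * M := Nat.mul_pos (Nat.succ_pos _) (Nat.succ_pos _)
  rcases hcases with hcomm | ⟨E, hbot, htop, hE⟩
  · exact ⟨H, hH.trans (Nat.le_mul_of_pos_left N hMM), fun a ha b hb ↦
      LinearMap.ext fun x ↦ DFunLike.congr_fun (hcomm a ha b hb).eq x⟩
  have restrict : ∀ F : Submodule ℂ V, F ≠ ⊤ → (∀ h ∈ H, ∀ x ∈ F, ρ h x ∈ F) →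
      ∃ A : Subgroup H, A.index ≤ M ∧
        ∀ a ∈ A, ∀ b ∈ A, ∀ x ∈ F, ρ a (ρ b x) = ρ b (ρ a x) := by
    intro F hF hinv
    let σ : Representation ℂ H F :=
      { toFun h := (ρ h).restrict (hinv h h.2)
        map_one' := by ext; simp
        map_mul' a b := by ext; simp }
    have hlt : Module.finrank ℂ F < n := hV ▸ Submodule.finrank_lt hF
    obtain ⟨A, hA, hcomm⟩ := hJ _ hlt F rfl H σ
    refine ⟨A, hA.trans (hM _ hlt), fun a ha b hb x hx ↦ ?_⟩
    exact congrArg Subtype.val (DFunLike.congr_fun (hcomm a ha b hb).eq ⟨x, hx⟩)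
  obtain ⟨A, hA, hAcomm⟩ := restrict E htop fun h hh ↦ (hE h hh).1
  obtain ⟨B, hB, hBcomm⟩ := restrict Eᗮ (fun h ↦ hbot (E.orthogonal_eq_top_iff.1 h))
    fun h hh ↦ (hE h hh).2
  refine ⟨(A ⊓ B).map H.subtype, ?_, ?_⟩
  · rw [Subgroup.index_map_subtype]
    exact Nat.mul_le_mul (Subgroup.index_inf_le.trans (Nat.mul_le_mul hA hB)) hH
  · rintro _ ⟨a, ha, rfl⟩ _ ⟨b, hb, rfl⟩
    refine LinearMap.ext fun x ↦ ?_
    obtain ⟨y, hy, z, hz, rfl⟩ := E.exists_add_mem_mem_orthogonal x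
    change ρ a (ρ b (y + z)) = ρ b (ρ a (y + z))
    simp only [map_add, hAcomm a ha.1 b hb.1 y hy, hBcomm a ha.2 b hb.2 z hz]

section Lifting

/-- An averaging argument: a map from a finite group to a ring which is multiplicative modulo `r`
can be corrected modulo `r` to a map which is multiplicative modulo `r * r`. -/
theorem exists_mul_congr_sq {R S G : Type} [CommRing R] [Ring S] [Algebra R S] [Group G] [Fintype G]
    {u : R} (hu : u * Fintype.card G = 1) (r : R) (f : G → S) (h1 : f 1 = 1)
    (hf : ∀ g h, ∃ z, f (g * h) - f g * f h = r • z) :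
    ∃ f' : G → S, f' 1 = 1 ∧ (∀ g, ∃ z, f' g - f g = r • z) ∧
      ∀ g h, ∃ z, f' (g * h) - f' g * f' h = (r * r) • z := by
  choose e he using hf
  let E : G → G → S := fun g h ↦ f (g * h) - f g * f h
  let A : G → S := fun g ↦ u • ∑ h, E g h * f h⁻¹
  have hA : ∀ g, A g = r • u • ∑ h, e g h * f h⁻¹ := fun g ↦ by
    simp only [A, E, he, smul_mul_assoc, ← Finset.smul_sum, smul_comm r u]
  refine ⟨fun g ↦ f g + A g, ?_, fun g ↦ ⟨_, by rw [add_sub_cancel_left, hA]⟩, fun g k ↦ ?_⟩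
  · simp [A, E, h1]
  have havg : ∀ x : S, x = u • ∑ _h : G, x := fun x ↦ by
    rw [Finset.sum_const, Finset.card_univ, ← Nat.cast_smul_eq_nsmul R, smul_smul, hu, one_smul]
  have hshift : ∑ h, E g h * f h⁻¹ * f k = ∑ h, E g (k * h) * f (k * h)⁻¹ * f k :=
    (Equiv.sum_comp (Equiv.mulLeft k) fun h ↦ E g h * f h⁻¹ * f k).symm
  have key : E g k + A (g * k) - f g * A k - A g * f k =
      u • ∑ h, (E g (k * h) * E (k * h)⁻¹ k + E g k * E h h⁻¹) := by
    calc _ = u • (∑ h, (E g k + E (g * k) h * f h⁻¹ - f g * (E k h * f h⁻¹)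
                - E g (k * h) * f (k * h)⁻¹ * f k)) := by
            simp only [Finset.sum_sub_distrib, Finset.sum_add_distrib, smul_sub, smul_add,
              ← havg, ← hshift, ← Finset.mul_sum, ← Finset.sum_mul]
            simp only [A, mul_smul_comm, smul_mul_assoc]
      _ = _ := by
            congr 1
            refine Finset.sum_congr rfl fun h _ ↦ ?_
            have h2 : (k * h)⁻¹ * k = h⁻¹ := by group
            simp only [E, h2, mul_inv_cancel, h1, mul_assoc g k h]
            noncomm_ring
  refine ⟨u • ∑ h, (e g (k * h) * e (k * h)⁻¹ k + e g k * e h h⁻¹) -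
    (u • ∑ h, e g h * f h⁻¹) * (u • ∑ h, e k h * f h⁻¹), ?_⟩
  calc _ = (E g k + A (g * k) - f g * A k - A g * f k) - A g * A k := by
          simp only [E]; noncomm_ring
    _ = _ := by
          rw [key, hA, hA]
          simp only [E, he, smul_mul_smul_comm, smul_sub, ← smul_add, ← Finset.smul_sum,
            smul_comm (r * r) u]

/-- Lifting representations of finite groups of invertible order along an adically complete ring. -/
theorem exists_monoidHom_congr {R G : Type} [CommRing R] [Group G] [Fintype G] {n : ℕ} {u q : R}
    [IsAdicComplete (Ideal.span {q}) R]
    (hu : u * Fintype.card G = 1) (f : G → Matrix (Fin n) (Fin n) R) (h1 : f 1 = 1)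
    (hf : ∀ g h, ∃ z, f (g * h) - f g * f h = q • z) :
    ∃ F : G →* Matrix (Fin n) (Fin n) R, ∀ g i j, q ∣ F g i j - f g i j := by
  have smod : ∀ (m : ℕ) (x y : R),
      x ≡ y [SMOD (Ideal.span {q} ^ m • ⊤ : Submodule R R)] ↔ q ^ m ∣ x - y := fun m x y ↦ by
    rw [SModEq.sub_mem, Ideal.span_singleton_pow, smul_eq_mul, Ideal.mul_top,
      Ideal.mem_span_singleton]
  let Good (m : ℕ) (f : G → Matrix (Fin n) (Fin n) R) : Prop :=
    f 1 = 1 ∧ ∀ g h, ∃ z, f (g * h) - f g * f h = q ^ (m + 1) • z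
  have step : ∀ m (f : G → Matrix (Fin n) (Fin n) R), Good m f →
      ∃ f', Good (m + 1) f' ∧ ∀ g, ∃ z, f' g - f g = q ^ (m + 1) • z := by
    rintro m f ⟨h1, hf⟩
    obtain ⟨f', h1', hclose, hf'⟩ := exists_mul_congr_sq hu _ f h1 hf
    refine ⟨f', ⟨h1', fun g h ↦ ?_⟩, hclose⟩
    obtain ⟨z, hz⟩ := hf' g h
    exact ⟨q ^ m • z, by rw [hz, smul_smul]; congr 1; ring⟩
  choose! next hnext hclose using step
  let s : ℕ → G → Matrix (Fin n) (Fin n) R := fun m ↦ Nat.rec f next m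
  have hs : ∀ m, Good m (s m) := fun m ↦ by
    induction m with
    | zero => exact ⟨h1, by simpa [s] using hf⟩
    | succ m ih => exact hnext m _ ih
  have hsucc : ∀ m g i j, q ^ (m + 1) ∣ s (m + 1) g i j - s m g i j := fun m g i j ↦ by
    obtain ⟨z, hz⟩ := hclose m _ (hs m) g
    exact ⟨z i j, congrFun (congrFun hz i) j⟩
  have hcauchy : ∀ g i j {m l : ℕ}, m ≤ l → q ^ m ∣ s m g i j - s l g i j := by
    intro g i j m l hml
    induction l, hml using Nat.le_induction with
    | base => simp
    | succ l hml ih =>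
      have := dvd_sub ih ((pow_dvd_pow q (by lia)).trans (hsucc l g i j))
      simpa using this
  have hlim : ∀ g i j, ∃ L, ∀ m, q ^ m ∣ s m g i j - L := fun g i j ↦ by
    obtain ⟨L, hL⟩ := IsPrecomplete.prec (I := Ideal.span {q}) inferInstance
      (f := fun m ↦ s m g i j) fun {m l} hml ↦ (smod _ _ _).2 (hcauchy g i j hml)
    exact ⟨L, fun m ↦ (smod _ _ _).1 (hL m)⟩
  choose L hL using hlim
  have haus : ∀ x y : R, (∀ m, q ^ m ∣ x - y) → x = y := fun x y h ↦
    IsHausdorff.eq_iff_smodEq (I := Ideal.span {q}).2 fun m ↦ (smod _ _ _).2 (h m)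
  refine ⟨{ toFun g := Matrix.of (L g), map_one' := ?_, map_mul' g h := ?_ }, fun g i j ↦ ?_⟩
  · ext i j
    refine haus _ _ fun m ↦ ?_
    have := hL 1 i j m
    rw [(hs m).1] at this
    simpa using (dvd_sub_comm).1 this
  · ext i j
    refine haus _ _ fun m ↦ ?_
    obtain ⟨z, hz⟩ := (hs m).2 g h
    have e1 := hL (g * h) i j m
    have e2 : q ^ m ∣ s m (g * h) i j - ∑ k, s m g i k * s m h k j := by
      refine (pow_dvd_pow q m.le_succ).trans ⟨z i j, ?_⟩
      have := congrFun (congrFun hz i) j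
      simpa [Matrix.mul_apply] using this
    have e3 : q ^ m ∣ ∑ k, s m g i k * s m h k j - ∑ k, L g i k * L h k j := by
      rw [← Finset.sum_sub_distrib]
      refine Finset.dvd_sum fun k _ ↦ ?_
      have : s m g i k * s m h k j - L g i k * L h k j =
          (s m g i k - L g i k) * s m h k j + (s m h k j - L h k j) * L g i k := by ring
      rw [this]
      exact dvd_add ((hL g i k m).mul_right _) ((hL h k j m).mul_right _)
    have := dvd_add (dvd_sub e2 e1) e3
    simpa [Matrix.mul_apply] using this
  · have := dvd_sub (hsucc 0 g i j) (hL g i j 1)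
    rw [zero_add, pow_one] at this
    simpa [s] using this

end Lifting

section Reduction

open Cardinal

/-- A prime-to-`p` linear group over a perfect field lifts to its ring of Witt vectors. -/
theorem exists_injective_monoidHom_wittVector {p : ℕ} [Fact p.Prime] {k G : Type} [Field k]
    [CharP k p] [PerfectRing k p] [Group G] [Finite G] (hG : ¬ p ∣ Nat.card G) {n : ℕ}
    (ρ : G →* Matrix (Fin n) (Fin n) k) (hρ : Function.Injective ρ) :
    ∃ F : G →* Matrix (Fin n) (Fin n) (WittVector p k), Function.Injective F := by
  have := Fintype.ofFinite G
  have hdvd : ∀ x : WittVector p k, (p : WittVector p k) ∣ x ↔ WittVector.constantCoeff x = 0 :=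
    fun x ↦ by
      rw [← Ideal.mem_span_singleton, WittVector.mem_span_p_iff_coeff_zero_eq_zero]
      rfl
  obtain ⟨u, hu⟩ : ∃ u : WittVector p k, u * Fintype.card G = 1 := by
    refine isUnit_iff_exists_inv'.1 (WittVector.isUnit_of_coeff_zero_ne_zero _ ?_)
    change WittVector.constantCoeff (Fintype.card G : WittVector p k) ≠ 0
    rwa [map_natCast, Ne, CharP.cast_eq_zero_iff k p, ← Nat.card_eq_fintype_card]
  let T : k →* WittVector p k := WittVector.teichmuller p
  have hT : ∀ x, WittVector.constantCoeff (T x) = x := WittVector.teichmuller_coeff_zero p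
  let f : G → Matrix (Fin n) (Fin n) (WittVector p k) := fun g ↦ (ρ g).map T
  have hf : ∀ g, (f g).map WittVector.constantCoeff = ρ g := fun g ↦ by ext; simp [f, hT]
  obtain ⟨F, hF⟩ := exists_monoidHom_congr hu f
    (by simp only [f, map_one]; exact Matrix.map_one _ (WittVector.teichmuller_zero p) (map_one T))
    fun g h ↦ by
      have hdiv : ∀ i j, (p : WittVector p k) ∣ (f (g * h) - f g * f h) i j := fun i j ↦ by
        rw [hdvd]
        have : (f (g * h) - f g * f h).map WittVector.constantCoeff = 0 := by
          rw [Matrix.map_sub _ (map_sub _), Matrix.map_mul, hf, hf, hf, map_mul, sub_self]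
        exact congrFun (congrFun this i) j
      choose z hz using hdiv
      exact ⟨Matrix.of z, by ext1 i j; exact hz i j⟩
  refine ⟨F, fun g h hgh ↦ hρ ?_⟩
  have hFρ : ∀ g, (F g).map WittVector.constantCoeff = ρ g := fun g ↦ by
    rw [← hf]
    ext i j
    exact sub_eq_zero.1 ((map_sub _ _ _).symm.trans ((hdvd _).1 (hF g i j)))
  rw [← hFρ, ← hFρ, hgh]

/-- The Witt vectors over a countable field embed into the complex numbers. -/
theorem exists_injective_wittVector_to_complex {p : ℕ} [Fact p.Prime] {k : Type} [Field k]
    [CharP k p] [PerfectRing k p] [Countable k] :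
    ∃ φ : WittVector p k →+* ℂ, Function.Injective φ := by
  let K := FractionRing (WittVector p k)
  have hinj : Function.Injective (algebraMap (WittVector p k) (AlgebraicClosure K)) :=
    (algebraMap K (AlgebraicClosure K)).injective.comp (IsFractionRing.injective _ K)
  have : CharZero (WittVector p k) := by
    obtain ⟨ℓ, hℓ⟩ := CharP.exists (WittVector p k)
    rcases CharP.char_is_prime_or_zero (WittVector p k) ℓ with hprime | rfl
    · have h0 : (ℓ : k) = 0 := by
        rw [← map_natCast (WittVector.constantCoeff (p := p) (R := k)), CharP.cast_eq_zero, map_zero]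
      have : p = ℓ := (Nat.prime_dvd_prime_iff_eq Fact.out hprime).1
        ((CharP.cast_eq_zero_iff k p ℓ).1 h0)
      subst this
      exact absurd (CharP.cast_eq_zero (WittVector p k) p) (WittVector.p_nonzero p k)
    · exact CharP.charP_to_charZero _
  have : CharZero (AlgebraicClosure K) := charZero_of_injective_algebraMap hinj
  have hW : #(WittVector p k) = #ℂ := by
    have e : WittVector p k ≃ (ℕ → k) :=
      ⟨WittVector.coeff, WittVector.mk p, fun _ ↦ rfl, fun _ ↦ rfl⟩
    rw [mk_complex, mk_congr e, ← power_def, mk_nat]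
    exact le_antisymm ((power_le_power_right mk_le_aleph0).trans_eq aleph0_power_aleph0)
      (two_power_aleph0.symm.trans_le (power_le_power_right
        ((two_le_iff_one_lt).2 (one_lt_iff_nontrivial.2 inferInstance))))
  have hK : #(AlgebraicClosure K) = #ℂ := by
    refine le_antisymm ?_ (hW ▸ mk_le_of_injective hinj)
    refine (Algebra.IsAlgebraic.cardinalMk_le_max K _).trans (max_le ?_ ?_)
    · rw [FractionRing.cardinalMk, hW]
    · rw [mk_complex]; exact aleph0_le_continuum
  obtain ⟨e⟩ := IsAlgClosed.ringEquiv_of_equiv_of_charZero (K := ℂ) (L := AlgebraicClosure K)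
    (by rw [mk_complex]; exact aleph0_lt_continuum) (Cardinal.eq.1 hK.symm)
  exact ⟨e.symm.toRingHom.comp (algebraMap _ _), e.symm.injective.comp hinj⟩

/-- A finite linear group is defined over a countable field. -/
theorem exists_injective_monoidHom_countable {k G : Type} [Field k] [Group G] [Finite G] {n : ℕ}
    (ρ : G →* Matrix (Fin n) (Fin n) k) (hρ : Function.Injective ρ) :
    ∃ (k₀ : Subfield k) (ρ₀ : G →* Matrix (Fin n) (Fin n) k₀), Countable k₀ ∧
      Function.Injective ρ₀ := by
  let s : Set k := Set.range fun x : G × Fin n × Fin n ↦ ρ x.1 x.2.1 x.2.2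
  have hs : s.Finite := Set.finite_range _
  refine ⟨Subfield.closure s, { toFun g := Matrix.of fun i j ↦
    ⟨ρ g i j, Subfield.subset_closure ⟨(g, i, j), rfl⟩⟩, map_one' := ?_, map_mul' g h := ?_ }, ?_, ?_⟩
  · ext i j
    simp [Matrix.one_apply, apply_ite]
  · ext i j
    simp [Matrix.mul_apply]
  · refine mk_le_aleph0_iff.1 ((Subfield.cardinalMk_closure_le_max s).trans (max_le ?_ le_rfl))
    exact mk_le_aleph0_iff.2 hs.countable
  · intro g h hgh
    refine hρ (Matrix.ext fun i j ↦ ?_)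
    exact congrArg Subtype.val (congrFun (congrFun hgh i) j)

/-- A prime-to-`p` linear group in characteristic `p` is isomorphic to a complex linear group of the
same degree. -/
theorem exists_injective_monoidHom_complex {p : ℕ} [Fact p.Prime] {k G : Type} [Field k]
    [CharP k p] [Group G] [Finite G] (hG : ¬ p ∣ Nat.card G) {n : ℕ}
    (ρ : G →* Matrix (Fin n) (Fin n) k) (hρ : Function.Injective ρ) :
    ∃ F : G →* Matrix (Fin n) (Fin n) ℂ, Function.Injective F := by
  obtain ⟨k₀, ρ₀, hk₀, hρ₀⟩ := exists_injective_monoidHom_countable ρ hρ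
  have : CharP k₀ p := (algebraMap k₀ k).charP (algebraMap k₀ k).injective p
  let K := AlgebraicClosure k₀
  have : CharP K p := charP_of_injective_algebraMap (algebraMap k₀ K).injective p
  have : Countable K := mk_le_aleph0_iff.1
    ((Algebra.IsAlgebraic.cardinalMk_le_max k₀ K).trans (max_le mk_le_aleph0 le_rfl))
  obtain ⟨F, hF⟩ := exists_injective_monoidHom_wittVector hG
    ((algebraMap k₀ K).mapMatrix.toMonoidHom.comp ρ₀)
    ((Matrix.map_injective (algebraMap k₀ K).injective).comp hρ₀)
  obtain ⟨φ, hφ⟩ := exists_injective_wittVector_to_complex (p := p) (k := K)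
  exact ⟨φ.mapMatrix.toMonoidHom.comp F,
    (Matrix.map_injective hφ).comp hF⟩

end Reduction


/-- For every positive integer `n` there is a constant `J` such that for every
prime `p`, every field `k` of characteristic `p`, and every finite subgroup `Γ`
of `GL_n(k)` of order not divisible by `p`, `Γ` contains a normal abelian
subgroup `A` of index at most `J`. -/
theorem stmt_1 (n : ℕ) (hn : 0 < n) :
    ∃ J : ℕ, ∀ (p : ℕ), p.Prime → ∀ (k : Type) [Field k] [CharP k p],
      ∀ Γ : Subgroup (Matrix.GeneralLinearGroup (Fin n) k), Finite Γ →
        ¬ p ∣ Nat.card Γ →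
        ∃ A : Subgroup Γ, A.Normal ∧ (∀ x y : A, x * y = y * x) ∧ A.index ≤ J := by
  obtain ⟨J, hJ⟩ := exists_index_le_of_complex_representation n
  refine ⟨J.factorial, fun p hp k _ _ Γ _ hΓ ↦ ?_⟩
  have : Fact p.Prime := ⟨hp⟩
  obtain ⟨F, hF⟩ := exists_injective_monoidHom_complex hΓ
    ((Units.coeHom (Matrix (Fin n) (Fin n) k)).comp Γ.subtype)
    (Units.val_injective.comp Subtype.val_injective)
  let ρ : Representation ℂ Γ (Fin n → ℂ) :=
    (Matrix.toLinAlgEquiv' : Matrix (Fin n) (Fin n) ℂ ≃ₐ[ℂ] _).toMonoidHom.comp F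
  have hρ : Function.Injective ρ := Matrix.toLinAlgEquiv'.injective.comp hF
  obtain ⟨A, hA, hcomm⟩ := hJ (Fin n → ℂ) (by simp) Γ ρ
  refine ⟨A.normalCore, inferInstance, fun x y ↦ Subtype.ext (hρ ?_),
    (Nat.le_of_dvd (Nat.factorial_pos _) (index_normalCore_dvd_factorial A)).trans
      (Nat.factorial_le hA)⟩
  simpa using (hcomm x (A.normalCore_le x.2) y (A.normalCore_le y.2)).eq
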